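/- arXiv:1710.00539 — 4 statements merged into one kernel-verified Lean document; each statement's English description precedes it below -/
import Mathlib

section
/- Surjectivity/inverse formula for the Euclidean SRVT: let q : [0,1] → ℝ^d be continuous with q(s) ≠ 0 for all s, and define c(t) := ∫₀ᵗ ‖q(s)‖ · q(s) ds. Then c is differentiable on [0,1] with c'(t) = ‖q(t)‖ · q(t) ≠ 0 for all t (so c is an immersion), c(0) = 0, and the SRVT of c equals q, i.e. c'(t)/√‖c'(t)‖ = q(t) for all t ∈ [0,1]. -/
/-- Surjectivity/inverse formula for the Euclidean SRVT: if `q : [0,1] → ℝᵈ` is continuous and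
nowhere vanishing, then `c t = ∫₀ᵗ ‖q s‖ • q s ds` is an immersion starting at `0` whose
SRVT `c' / √‖c'‖` equals `q`. -/
theorem srvt_inverse_euclidean (d : ℕ) (hd : 1 ≤ d) (q : ℝ → EuclideanSpace ℝ (Fin d))
    (hq : ContinuousOn q (Set.Icc 0 1)) (hq0 : ∀ s ∈ Set.Icc (0 : ℝ) 1, q s ≠ 0) :
    let c : ℝ → EuclideanSpace ℝ (Fin d) := fun t => ∫ s in (0 : ℝ)..t, ‖q s‖ • q s
    (∀ t ∈ Set.Icc (0 : ℝ) 1, HasDerivWithinAt c (‖q t‖ • q t) (Set.Icc 0 1) t) ∧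
    (∀ t ∈ Set.Icc (0 : ℝ) 1, ‖q t‖ • q t ≠ 0) ∧
    c 0 = 0 ∧
    (∀ t ∈ Set.Icc (0 : ℝ) 1, (Real.sqrt ‖‖q t‖ • q t‖)⁻¹ • (‖q t‖ • q t) = q t) := by
  have hf : ContinuousOn (fun s => ‖q s‖ • q s) (Set.Icc 0 1) := hq.norm.smul hq
  intro c
  refine ⟨fun t ht => ?_, fun t ht => ?_, intervalIntegral.integral_same, fun t ht => ?_⟩
  · have : Fact (t ∈ Set.Icc (0 : ℝ) 1) := ⟨ht⟩
    refine intervalIntegral.integral_hasDerivWithinAt_right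
      (ContinuousOn.intervalIntegrable ?_)
      (hf.stronglyMeasurableAtFilter_nhdsWithin measurableSet_Icc t) (hf t ht)
    rw [Set.uIcc_of_le ht.1]
    exact hf.mono (Set.Icc_subset_Icc_right ht.2)
  · exact smul_ne_zero (norm_ne_zero_iff.mpr (hq0 t ht)) (hq0 t ht)
  · rw [norm_smul, norm_norm, Real.sqrt_mul_self (norm_nonneg _),
      inv_smul_smul₀ (norm_ne_zero_iff.mpr (hq0 t ht))]
end

section
/- Injectivity of the Euclidean SRVT: let c₀, c₁ : [0,1] → ℝ^d be differentiable curves with nowhere-vanishing derivatives, with c₀(0) = c₁(0), and suppose their SRVTs agree, i.e. c₀'(t)/√‖c₀'(t)‖ = c₁'(t)/√‖c₁'(t)‖ for all t ∈ [0,1]. Then c₀(t) = c₁(t) for all t ∈ [0,1]. -/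
theorem norm_inv_sqrt_norm_smul {E : Type*} [NormedAddCommGroup E] [NormedSpace ℝ E] (v : E) :
    ‖(Real.sqrt ‖v‖)⁻¹ • v‖ = Real.sqrt ‖v‖ := by
  rw [norm_smul, norm_inv, Real.norm_of_nonneg (Real.sqrt_nonneg _), inv_mul_eq_div,
    Real.div_sqrt]

theorem inv_sqrt_norm_smul_injective {E : Type*} [NormedAddCommGroup E] [NormedSpace ℝ E] :
    Function.Injective fun v : E => (Real.sqrt ‖v‖)⁻¹ • v := by
  intro v w h
  have hsqrt : Real.sqrt ‖v‖ = Real.sqrt ‖w‖ := by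
    simpa only [norm_inv_sqrt_norm_smul] using congrArg norm h
  by_cases hw : w = 0
  · simpa [hw] using hsqrt
  · have hne : (Real.sqrt ‖w‖)⁻¹ ≠ 0 :=
      inv_ne_zero (Real.sqrt_pos.2 (norm_pos_iff.2 hw)).ne'
    simp only [hsqrt] at h
    exact smul_right_injective E hne h

/-- Injectivity of the Euclidean SRVT: two immersions with the same starting point and the same
SRVT coincide on `[0,1]`. -/
theorem srvt_injective_euclidean (d : ℕ) (hd : 1 ≤ d)
    (c₀ c₁ c₀' c₁' : ℝ → EuclideanSpace ℝ (Fin d))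
    (hc₀ : ∀ t ∈ Set.Icc (0 : ℝ) 1, HasDerivWithinAt c₀ (c₀' t) (Set.Icc 0 1) t)
    (hc₁ : ∀ t ∈ Set.Icc (0 : ℝ) 1, HasDerivWithinAt c₁ (c₁' t) (Set.Icc 0 1) t)
    (hc₀' : ∀ t ∈ Set.Icc (0 : ℝ) 1, c₀' t ≠ 0)
    (hc₁' : ∀ t ∈ Set.Icc (0 : ℝ) 1, c₁' t ≠ 0)
    (h0 : c₀ 0 = c₁ 0)
    (hsrvt : ∀ t ∈ Set.Icc (0 : ℝ) 1,
      (Real.sqrt ‖c₀' t‖)⁻¹ • c₀' t = (Real.sqrt ‖c₁' t‖)⁻¹ • c₁' t) :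
    ∀ t ∈ Set.Icc (0 : ℝ) 1, c₀ t = c₁ t := by
  have hderiv : ∀ t ∈ Set.Icc (0 : ℝ) 1, c₀' t = c₁' t := fun t ht =>
    inv_sqrt_norm_smul_injective (hsrvt t ht)
  have huniq : UniqueDiffOn ℝ (Set.Icc (0 : ℝ) 1) := uniqueDiffOn_Icc_zero_one
  refine eq_of_derivWithin_eq (fun t ht => (hc₀ t ht).differentiableWithinAt)
    (fun t ht => (hc₁ t ht).differentiableWithinAt) (fun t ht => ?_) h0
  have ht' := Set.Ico_subset_Icc_self ht
  rw [(hc₀ t ht').derivWithin (huniq t ht'), (hc₁ t ht').derivWithin (huniq t ht'), hderiv t ht']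
end

section
/- Reparametrization invariance of the L² distance between SRVTs: let c₀, c₁ : [0,1] → ℝ^d be continuously differentiable curves with nowhere-vanishing derivatives and let φ : [0,1] → [0,1] be continuously differentiable with φ' > 0, φ(0) = 0 and φ(1) = 1. Then ∫₀¹ ‖R(c₀ ∘ φ)(t) − R(c₁ ∘ φ)(t)‖² dt = ∫₀¹ ‖R(c₀)(t) − R(c₁)(t)‖² dt. -/
/-- Scaling a vector by `a ≥ 0` scales its square root velocity vector by `√a`. -/
theorem inv_sqrt_norm_smul_smul {E : Type*} [NormedAddCommGroup E] [NormedSpace ℝ E]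
    {a : ℝ} (ha : 0 ≤ a) (v : E) :
    (Real.sqrt ‖a • v‖)⁻¹ • (a • v) = Real.sqrt a • ((Real.sqrt ‖v‖)⁻¹ • v) := by
  rw [norm_smul, Real.norm_of_nonneg ha, Real.sqrt_mul ha, mul_inv, smul_smul, smul_smul]
  congr 1
  rw [mul_right_comm, inv_mul_eq_div, Real.div_sqrt]

/-- The squared distance between square root velocity vectors is homogeneous of degree one. -/
theorem norm_sub_sq_inv_sqrt_norm_smul_smul {E : Type*} [NormedAddCommGroup E]
    [NormedSpace ℝ E] {a : ℝ} (ha : 0 ≤ a) (v w : E) :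
    ‖(Real.sqrt ‖a • v‖)⁻¹ • (a • v) - (Real.sqrt ‖a • w‖)⁻¹ • (a • w)‖ ^ 2
      = ‖(Real.sqrt ‖v‖)⁻¹ • v - (Real.sqrt ‖w‖)⁻¹ • w‖ ^ 2 * a := by
  rw [inv_sqrt_norm_smul_smul ha, inv_sqrt_norm_smul_smul ha, ← smul_sub, norm_smul, mul_pow,
    Real.norm_of_nonneg (Real.sqrt_nonneg a), Real.sq_sqrt ha, mul_comm]

/-- Reparametrization invariance of the L² distance between SRVTs: for C¹ immersions `c₀, c₁`
and an orientation-preserving C¹ reparametrization `φ` of `[0,1]`,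
`∫₀¹ ‖R(c₀∘φ)(t) − R(c₁∘φ)(t)‖² dt = ∫₀¹ ‖R(c₀)(t) − R(c₁)(t)‖² dt`, where
`R(cᵢ∘φ)(t) = (φ'(t) • cᵢ'(φ t)) / √‖φ'(t) • cᵢ'(φ t)‖` by the chain rule. -/
theorem srvt_L2_reparametrization_invariance (d : ℕ) (hd : 1 ≤ d)
    (c₀ c₁ c₀' c₁' : ℝ → EuclideanSpace ℝ (Fin d)) (φ φ' : ℝ → ℝ)
    (hc₀ : ∀ t ∈ Set.Icc (0 : ℝ) 1, HasDerivWithinAt c₀ (c₀' t) (Set.Icc 0 1) t)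
    (hc₁ : ∀ t ∈ Set.Icc (0 : ℝ) 1, HasDerivWithinAt c₁ (c₁' t) (Set.Icc 0 1) t)
    (hc₀'cont : ContinuousOn c₀' (Set.Icc 0 1))
    (hc₁'cont : ContinuousOn c₁' (Set.Icc 0 1))
    (hc₀' : ∀ t ∈ Set.Icc (0 : ℝ) 1, c₀' t ≠ 0)
    (hc₁' : ∀ t ∈ Set.Icc (0 : ℝ) 1, c₁' t ≠ 0)
    (hφmaps : ∀ t ∈ Set.Icc (0 : ℝ) 1, φ t ∈ Set.Icc (0 : ℝ) 1)
    (hφ : ∀ t ∈ Set.Icc (0 : ℝ) 1, HasDerivWithinAt φ (φ' t) (Set.Icc 0 1) t)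
    (hφ'cont : ContinuousOn φ' (Set.Icc 0 1))
    (hφ' : ∀ t ∈ Set.Icc (0 : ℝ) 1, 0 < φ' t)
    (hφ0 : φ 0 = 0) (hφ1 : φ 1 = 1) :
    (∫ t in (0 : ℝ)..1,
        ‖(Real.sqrt ‖φ' t • c₀' (φ t)‖)⁻¹ • (φ' t • c₀' (φ t))
          - (Real.sqrt ‖φ' t • c₁' (φ t)‖)⁻¹ • (φ' t • c₁' (φ t))‖ ^ 2)
      = ∫ t in (0 : ℝ)..1,
        ‖(Real.sqrt ‖c₀' t‖)⁻¹ • c₀' t - (Real.sqrt ‖c₁' t‖)⁻¹ • c₁' t‖ ^ 2 := by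
  have hsub := intervalIntegral.integral_comp_mul_deriv_of_deriv_nonneg (a := 0) (b := 1)
    (f := φ) (f' := φ')
    (g := fun t => ‖(Real.sqrt ‖c₀' t‖)⁻¹ • c₀' t - (Real.sqrt ‖c₁' t‖)⁻¹ • c₁' t‖ ^ 2)
    (by
      rw [Set.uIcc_of_le zero_le_one]
      exact fun t ht => (hφ t ht).continuousWithinAt)
    (by
      rw [min_eq_left zero_le_one, max_eq_right zero_le_one]
      exact fun t ht => (hφ t (Set.Ioo_subset_Icc_self ht)).hasDerivAt
        (Icc_mem_nhds ht.1 ht.2))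
    (by
      rw [min_eq_left zero_le_one, max_eq_right zero_le_one]
      exact fun t ht => (hφ' t (Set.Ioo_subset_Icc_self ht)).le)
  rw [hφ0, hφ1] at hsub
  rw [← hsub]
  refine intervalIntegral.integral_congr fun t ht => ?_
  rw [Set.uIcc_of_le zero_le_one] at ht
  exact norm_sub_sq_inv_sqrt_norm_smul_smul (hφ' t ht).le _ _
end

section
/- Pointwise elastic-metric identity (the integrand of the pullback metric of Theorem 1): let d ≥ 1, v ∈ ℝ^d with v ≠ 0, u = v/‖v‖, and let q(v) = v/√‖v‖ with Fréchet derivative Dq(v). Then for all h, k ∈ ℝ^d, ⟨Dq(v)h, Dq(v)k⟩ = ‖v‖^{-1} ( ¼⟨h,u⟩⟨k,u⟩ + ⟨h − ⟨h,u⟩u, k − ⟨k,u⟩u⟩ ). -/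
open scoped RealInnerProductSpace

section

variable {E : Type*} [NormedAddCommGroup E] [InnerProductSpace ℝ E]

theorem hasFDerivAt_norm_of_ne_zero {v : E} (hv : v ≠ 0) :
    HasFDerivAt (fun w : E => ‖w‖) (‖v‖⁻¹ • innerSL ℝ v) v := by
  have h := (hasStrictFDerivAt_norm_sq v).hasFDerivAt.sqrt (pow_ne_zero 2 (norm_ne_zero_iff.2 hv))
  simp only [Real.sqrt_sq (norm_nonneg _)] at h
  refine h.congr_fderiv ?_
  ext x
  have := norm_ne_zero_iff.2 hv
  simp
  field_simp

/-- The derivative of `w ↦ w / √‖w‖` halves the radial component and scales by `1 / √‖v‖`. -/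
theorem HasFDerivAt.inv_sqrt_norm_smul_apply {v : E} (hv : v ≠ 0) {D : E →L[ℝ] E}
    (hD : HasFDerivAt (fun w : E => (Real.sqrt ‖w‖)⁻¹ • w) D v) (h : E) :
    D h = (Real.sqrt ‖v‖)⁻¹ • (h - (1 / 2 * ⟪h, ‖v‖⁻¹ • v⟫) • (‖v‖⁻¹ • v)) := by
  have hr : 0 < ‖v‖ := norm_pos_iff.2 hv
  have hs : 0 < √‖v‖ := Real.sqrt_pos.2 hr
  have hc := (hasDerivAt_inv hs.ne').comp_hasFDerivAt v
    ((hasFDerivAt_norm_of_ne_zero hv).sqrt hr.ne')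
  rw [hD.unique (hc.smul (hasFDerivAt_id v))]
  simp only [add_apply, smul_apply,
    ContinuousLinearMap.smulRight_apply, ContinuousLinearMap.id_apply, innerSL_apply_apply,
    Function.comp_apply, inner_smul_right, real_inner_comm h v, smul_eq_mul,
    Real.sq_sqrt hr.le]
  match_scalars <;> field_simp

end

/-- Pointwise elastic-metric identity: for the square-root scaling map `q(v) = v/√‖v‖` with
Fréchet derivative `D` at `v ≠ 0` and `u = v/‖v‖`,
`⟨D h, D k⟩ = ‖v‖⁻¹ (¼⟨h,u⟩⟨k,u⟩ + ⟨h − ⟨h,u⟩u, k − ⟨k,u⟩u⟩)`. -/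
theorem srvt_pullback_metric_pointwise (d : ℕ) (hd : 1 ≤ d)
    (v : EuclideanSpace ℝ (Fin d)) (hv : v ≠ 0)
    (D : EuclideanSpace ℝ (Fin d) →L[ℝ] EuclideanSpace ℝ (Fin d))
    (hD : HasFDerivAt (fun w : EuclideanSpace ℝ (Fin d) => (Real.sqrt ‖w‖)⁻¹ • w) D v) :
    ∀ h k : EuclideanSpace ℝ (Fin d),
      ⟪D h, D k⟫ = ‖v‖⁻¹ *
        ((1 / 4) * (⟪h, ‖v‖⁻¹ • v⟫ * ⟪k, ‖v‖⁻¹ • v⟫)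
          + ⟪h - ⟪h, ‖v‖⁻¹ • v⟫ • (‖v‖⁻¹ • v), k - ⟪k, ‖v‖⁻¹ • v⟫ • (‖v‖⁻¹ • v)⟫) := by
  intro h k
  have hr : ‖v‖ ≠ 0 := norm_ne_zero_iff.2 hv
  have hs : (√‖v‖)⁻¹ * (√‖v‖)⁻¹ = ‖v‖⁻¹ := by
    rw [← mul_inv, Real.mul_self_sqrt (norm_nonneg v)]
  rw [hD.inv_sqrt_norm_smul_apply hv h, hD.inv_sqrt_norm_smul_apply hv k, real_inner_smul_left,
    real_inner_smul_right, ← mul_assoc, hs]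
  have hu : ⟪‖v‖⁻¹ • v, ‖v‖⁻¹ • v⟫ = 1 := by
    rw [real_inner_self_eq_norm_sq, norm_smul, norm_inv, norm_norm, inv_mul_cancel₀ hr, one_pow]
  generalize ‖v‖⁻¹ • v = u at hu ⊢
  simp only [inner_sub_left, inner_sub_right, real_inner_smul_left, real_inner_smul_right, hu,
    real_inner_comm k u]
  ring
end
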